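/- Let p ≥ 1, let μ = (μ₁,…,μ_k) be a partition of p, and let ν = (ν₁,…,ν_ℓ) be a refinement of μ. Write the multisets Υ_μ = {a₁,…,a_p} and Υ_ν = {b₁,…,b_p}. Fix r = r₁/r₂ with r₁, r₂ positive integers, and suppose the series A = ∑_{m=0}^∞ ∏_{j=0}^{m-1} ((j+a₁)(j+a₂)⋯(j+a_p)·r) / ((j+b₁)(j+b₂)⋯(j+b_p)) converges to a finite value. Let c be a positive integer such that every prime dividing μ₁·μ₂·⋯·μ_k·r₂ also divides c. Then there exists a binomial multisum f : ℕ → ℕ such that f(n)/c^n → A as n → ∞. -/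

import Mathlib

/-- Modified binomial coefficient: `C(a,b) = a!/((a-b)!·b!)` if `0 ≤ b ≤ a`,
`C(-1,0) = 1`, and `0` otherwise. -/
def mbinom (a b : ℤ) : ℕ :=
  if 0 ≤ b ∧ b ≤ a then a.toNat.choose b.toNat
  else if a = -1 ∧ b = 0 then 1 else 0

/-- The general term of a binomial multisum, indexed by `v ∈ ℤ^d`. -/
def multisumTerm {r d : ℕ} (A B : Fin r → Fin d → ℤ) (a' a'' b' b'' : Fin r → ℤ)
    (n : ℕ) (v : Fin d → ℤ) : ℕ :=
  ∏ i, mbinom ((∑ j, A i j * v j) + a' i * (n : ℤ) + a'' i)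
              ((∑ j, B i j * v j) + b' i * (n : ℤ) + b'' i)

/-- `f : ℕ → ℕ` is a binomial multisum: for every `n` only finitely many `v ∈ ℤ^d`
contribute, and `f n` is the (finite) sum of the products of modified binomial
coefficients of integer-coefficient affine functions of `(v, n)`. -/
def IsBinomialMultisum (f : ℕ → ℕ) : Prop :=
  ∃ (r d : ℕ) (A B : Fin r → Fin d → ℤ) (a' a'' b' b'' : Fin r → ℤ),
    (∀ n : ℕ, (Function.support (multisumTerm A B a' a'' b' b'' n)).Finite) ∧
    ∀ n : ℕ, f n = ∑ᶠ v : Fin d → ℤ, multisumTerm A B a' a'' b' b'' n v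

/-- The multiset `Υ_λ = ⋃_i {1/λ_i, 2/λ_i, …, (λ_i-1)/λ_i, 1}` attached to a partition
`λ = (λ₁,…,λ_k)`. -/
def Upsilon {k : ℕ} (lam : Fin k → ℕ) : Multiset ℚ :=
  ∑ i, (Multiset.range (lam i)).map fun t => ((t : ℚ) + 1) / (lam i : ℚ)

open scoped ENNReal

/-- Finite products of modified binomial coefficients of linear forms on `G`. -/
inductive IsBinomialProduct {G : Type} [AddCommGroup G] : (G → ℕ) → Prop
  | one : IsBinomialProduct fun _ => 1
  | binom_mul (a b : G →+ ℤ) {P : G → ℕ} (hP : IsBinomialProduct P) :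
      IsBinomialProduct fun x => mbinom (a x) (b x) * P x

namespace IsBinomialProduct

variable {G H : Type} [AddCommGroup G] [AddCommGroup H]

theorem comp {P : H → ℕ} (hP : IsBinomialProduct P) (φ : G →+ H) :
    IsBinomialProduct fun x => P (φ x) := by
  induction hP with
  | one => exact one
  | binom_mul a b _ ih => exact binom_mul (a.comp φ) (b.comp φ) ih

theorem mul {P Q : G → ℕ} (hP : IsBinomialProduct P) (hQ : IsBinomialProduct Q) :
    IsBinomialProduct fun x => P x * Q x := by
  induction hP with
  | one => simpa using hQ
  | binom_mul a b _ ih => simpa only [mul_assoc] using binom_mul a b ih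

theorem prod {ι : Type*} (s : Finset ι) {P : ι → G → ℕ} (hP : ∀ i, IsBinomialProduct (P i)) :
    IsBinomialProduct fun x => ∏ i ∈ s, P i x := by
  classical
  induction s using Finset.induction_on with
  | empty => simpa using one
  | insert i s hi ih => simpa only [Finset.prod_insert hi] using (hP i).mul ih

end IsBinomialProduct

/-- Sums over `ℤ^d` of binomial products depending linearly on a parameter in `G`. -/
def IsParametricMultisum {G : Type} [AddCommGroup G] (F : G → ℕ) : Prop :=
  ∃ (d : ℕ) (P : G × (Fin d → ℤ) → ℕ), IsBinomialProduct P ∧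
    ∀ x, (F x : ℝ≥0∞) = ∑' v, (P (x, v) : ℝ≥0∞)

theorem IsBinomialProduct.isParametricMultisum {G : Type} [AddCommGroup G] {P : G → ℕ}
    (hP : IsBinomialProduct P) : IsParametricMultisum P :=
  ⟨0, _, hP.comp (AddMonoidHom.fst G (Fin 0 → ℤ)), fun x => by simp⟩

namespace IsParametricMultisum

variable {G H : Type} [AddCommGroup G] [AddCommGroup H]

theorem comp {F : H → ℕ} (hF : IsParametricMultisum F) (φ : G →+ H) :
    IsParametricMultisum fun x => F (φ x) := by
  obtain ⟨d, P, hP, h⟩ := hF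
  exact ⟨d, _, hP.comp (φ.prodMap (AddMonoidHom.id _)), fun x => h (φ x)⟩

theorem binom_mul {F : G → ℕ} (a b : G →+ ℤ) (hF : IsParametricMultisum F) :
    IsParametricMultisum fun x => mbinom (a x) (b x) * F x := by
  obtain ⟨d, P, hP, h⟩ := hF
  refine ⟨d, _, hP.binom_mul (a.comp (AddMonoidHom.fst _ _)) (b.comp (AddMonoidHom.fst _ _)),
    fun x => ?_⟩
  simp [h, ENNReal.tsum_mul_left]

theorem sum {F : G × ℤ → ℕ} (hF : IsParametricMultisum F) {S : G → ℕ}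
    (hS : ∀ x, (S x : ℝ≥0∞) = ∑' k, (F (x, k) : ℝ≥0∞)) : IsParametricMultisum S := by
  obtain ⟨d, P, hP, h⟩ := hF
  let φ : G × (Fin (d + 1) → ℤ) →+ (G × ℤ) × (Fin d → ℤ) :=
    { toFun := fun y => ((y.1, y.2 0), Fin.tail y.2)
      map_zero' := rfl
      map_add' := fun _ _ => rfl }
  refine ⟨d + 1, _, hP.comp φ, fun x => ?_⟩
  rw [hS, ← (Fin.consEquiv fun _ => ℤ).tsum_eq, ENNReal.tsum_prod']
  refine tsum_congr fun k => ?_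
  rw [h]
  rfl

end IsParametricMultisum

theorem mbinom_self (a : ℤ) : mbinom a a = if 0 ≤ a then 1 else 0 := by
  unfold mbinom
  split_ifs <;> first | omega | simp

theorem mbinom_natCast (a b : ℕ) : mbinom a b = a.choose b := by
  unfold mbinom
  split_ifs with h h'
  · simp
  · omega
  · rw [Nat.choose_eq_zero_of_lt (by omega)]

theorem mbinom_of_neg_right {a b : ℤ} (hb : b < 0) : mbinom a b = 0 := by
  unfold mbinom
  split_ifs <;> first | rfl | omega

theorem tsum_int_eq_tsum_nat_of_neg {F : ℤ → ℝ≥0∞} (h : ∀ k < 0, F k = 0) :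
    ∑' k, F k = ∑' k : ℕ, F k := by
  refine (Function.Injective.tsum_eq Nat.cast_injective fun k hk => ?_).symm
  by_contra hk'
  refine hk (h k ?_)
  by_contra! h0
  exact hk' ⟨k.toNat, Int.toNat_of_nonneg h0⟩

/-- `x ^ a` for `0 ≤ a`, and `0` for negative `a`. -/
def truncPow (x : ℕ) (a : ℤ) : ℕ := if 0 ≤ a then x ^ a.toNat else 0

theorem truncPow_natCast (x a : ℕ) : truncPow x a = x ^ a := by simp [truncPow]

theorem truncPow_of_neg (x : ℕ) {a : ℤ} (h : a < 0) : truncPow x a = 0 := by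
  simp [truncPow, h]

theorem truncPow_succ (x : ℕ) (a : ℤ) :
    (truncPow (x + 1) a : ℝ≥0∞) =
      ∑' k : ℤ, ((mbinom a a * (mbinom a k * truncPow x k) : ℕ) : ℝ≥0∞) := by
  rcases lt_or_ge a 0 with ha | ha
  · simp [truncPow_of_neg _ ha, mbinom_of_neg_right ha]
  lift a to ℕ using ha
  rw [tsum_int_eq_tsum_nat_of_neg fun k hk => by simp [truncPow_of_neg _ hk],
    tsum_eq_sum (s := Finset.range (a + 1))]
  · rw [truncPow_natCast, add_pow]
    push_cast
    refine Finset.sum_congr rfl fun k _ => ?_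
    simp [mbinom_natCast, truncPow_natCast, mul_comm]
  · intro k hk
    rw [Finset.mem_range, not_lt] at hk
    simp [mbinom_natCast, Nat.choose_eq_zero_of_lt (Nat.lt_of_succ_le hk)]

theorem IsParametricMultisum.truncPow_mul {x : ℕ} (hx : 0 < x) :
    ∀ {G : Type} [AddCommGroup G] {F : G → ℕ} (a : G →+ ℤ), IsParametricMultisum F →
      IsParametricMultisum fun y => truncPow x (a y) * F y := by
  induction x, hx using Nat.le_induction with
  | base =>
    intro G _ F a hF
    simpa [truncPow, mbinom_self] using hF.binom_mul a a
  | succ x hx ih =>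
    intro G _ F a hF
    let π : G × ℤ →+ G := AddMonoidHom.fst G ℤ
    let κ : G × ℤ →+ ℤ := AddMonoidHom.snd G ℤ
    refine (ih κ (((hF.comp π).binom_mul (a.comp π) κ).binom_mul (a.comp π) (a.comp π))).sum
      fun y => ?_
    rw [Nat.cast_mul, truncPow_succ, ← ENNReal.tsum_mul_right]
    refine tsum_congr fun k => ?_
    simp only [AddMonoidHom.comp_apply, π, κ, AddMonoidHom.coe_fst, AddMonoidHom.coe_snd]
    push_cast
    ring

theorem AddMonoidHom.apply_int_prod_pi {d : ℕ} (a : ℤ × (Fin d → ℤ) →+ ℤ) (n : ℤ)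
    (v : Fin d → ℤ) :
    a (n, v) = (∑ j, a (0, Pi.single j 1) * v j) + a (1, 0) * n := by
  have h : (n, v) = (∑ j, v j • ((0, Pi.single j 1) : ℤ × (Fin d → ℤ))) + n • (1, 0) := by
    ext i
    · simp [Prod.fst_sum]
    · simp [Prod.snd_sum, Finset.sum_apply, Pi.single_apply]
  conv_lhs => rw [h]
  simp only [map_add, map_sum, map_zsmul, smul_eq_mul, mul_comm]

theorem IsBinomialProduct.exists_multisumTerm {d : ℕ} {P : ℤ × (Fin d → ℤ) → ℕ}
    (hP : IsBinomialProduct P) :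
    ∃ (r : ℕ) (A B : Fin r → Fin d → ℤ) (a' a'' b' b'' : Fin r → ℤ),
      ∀ (n : ℕ) v, P (n, v) = multisumTerm A B a' a'' b' b'' n v := by
  induction hP with
  | one => exact ⟨0, 0, 0, 0, 0, 0, 0, by simp [multisumTerm]⟩
  | binom_mul a b _ ih =>
    obtain ⟨r, A, B, a', a'', b', b'', h⟩ := ih
    refine ⟨r + 1, Fin.cons (fun j => a (0, Pi.single j 1)) A,
      Fin.cons (fun j => b (0, Pi.single j 1)) B, Fin.cons (a (1, 0)) a', Fin.cons 0 a'',
      Fin.cons (b (1, 0)) b', Fin.cons 0 b'', fun n v => ?_⟩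
    simp only [h]
    rw [a.apply_int_prod_pi, b.apply_int_prod_pi]
    simp [multisumTerm, Fin.prod_univ_succ]

theorem IsParametricMultisum.isBinomialMultisum {F : ℤ → ℕ} (hF : IsParametricMultisum F) :
    IsBinomialMultisum fun n => F n := by
  obtain ⟨d, P, hP, h⟩ := hF
  obtain ⟨r, A, B, a', a'', b', b'', hT⟩ := hP.exists_multisumTerm
  have hfin : ∀ n : ℕ, (Function.support (multisumTerm A B a' a'' b' b'' n)).Finite := by
    intro n
    have htop : ∑' v, (P (n, v) : ℝ≥0∞) ≠ ⊤ := h n ▸ ENNReal.natCast_ne_top _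
    refine (ENNReal.finite_const_le_of_tsum_ne_top htop one_ne_zero).subset fun v hv => ?_
    rw [Set.mem_ofPred_eq, hT]
    exact_mod_cast Nat.one_le_iff_ne_zero.2 hv
  refine ⟨r, d, A, B, a', a'', b', b'', hfin, fun n => ?_⟩
  have hn := h n
  simp only [hT] at hn
  rw [tsum_eq_sum (s := (hfin n).toFinset) fun v hv => by simpa using hv, ← Nat.cast_sum] at hn
  rw [finsum_eq_sum _ (hfin n)]
  exact_mod_cast hn

/-- Multinomial coefficients of multiples of a linear form are binomial products. -/
theorem exists_isBinomialProduct_multinomial {G ι : Type} [AddCommGroup G] (κ : G →+ ℤ)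
    (ν : ι → ℕ) (s : Finset ι) :
    ∃ P : G → ℕ, IsBinomialProduct P ∧
      ∀ x (m : ℕ), κ x = m → P x = Nat.multinomial s fun j => ν j * m := by
  classical
  induction s using Finset.induction_on with
  | empty => exact ⟨_, .one, by simp⟩
  | insert i s hi ih =>
    obtain ⟨P, hP, h⟩ := ih
    refine ⟨_, hP.binom_mul ((ν i + ∑ j ∈ s, ν j) • κ) (ν i • κ), fun x m hx => ?_⟩
    rw [h x m hx, Nat.multinomial_insert hi, ← mbinom_natCast]
    simp [hx, add_mul, Finset.sum_mul]

theorem isBinomialMultisum_sum_multinomial {k l : ℕ} (ν : Fin l → ℕ) (g : Fin l → Fin k)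
    {x c K : ℕ} (hx : 0 < x) (hc : 0 < c) (hK : 0 < K) :
    IsBinomialMultisum fun n => ∑ m ∈ Finset.range (n / K + 1),
      c ^ (n - K * m) * (x ^ m *
        ∏ i, Nat.multinomial (Finset.univ.filter fun j => g j = i) fun j => ν j * m) := by
  let π : ℤ × ℤ →+ ℤ := AddMonoidHom.fst ℤ ℤ
  let κ : ℤ × ℤ →+ ℤ := AddMonoidHom.snd ℤ ℤ
  choose P hP hPm using fun i : Fin k =>
    exists_isBinomialProduct_multinomial κ ν (Finset.univ.filter fun j => g j = i)
  have hF := ((IsBinomialProduct.prod Finset.univ hP).isParametricMultisum.truncPow_mul hx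
    κ).truncPow_mul hc (π - K • κ)
  let S : ℤ → ℕ := fun n => if 0 ≤ n then ∑ m ∈ Finset.range (n.toNat / K + 1),
      c ^ (n.toNat - K * m) * (x ^ m *
        ∏ i, Nat.multinomial (Finset.univ.filter fun j => g j = i) fun j => ν j * m) else 0
  have hS : IsParametricMultisum S := by
    refine hF.sum fun n => ?_
    rw [tsum_int_eq_tsum_nat_of_neg fun m hm => by simp [κ, truncPow_of_neg _ hm]]
    rcases lt_or_ge n 0 with hn | hn
    · have hneg (m : ℕ) : n - K * (m : ℤ) < 0 := by
        have : (0 : ℤ) ≤ K * m := by positivity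
        omega
      simp [S, hn, π, κ, truncPow_of_neg _ (hneg _)]
    lift n to ℕ using hn
    rw [tsum_eq_sum (s := Finset.range (n / K + 1))]
    · simp only [S, Int.natCast_nonneg, if_true, Int.toNat_natCast, Nat.cast_sum]
      refine Finset.sum_congr rfl fun m hm => ?_
      have hle : K * m ≤ n := by
        rw [Finset.mem_range, Nat.lt_succ_iff, Nat.le_div_iff_mul_le hK] at hm
        rwa [mul_comm]
      have hL : (π - K • κ) ((n : ℤ), (m : ℤ)) = ((n - K * m : ℕ) : ℤ) := by
        simp [π, κ, Nat.cast_sub hle]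
      rw [hL, show κ ((n : ℤ), (m : ℤ)) = (m : ℤ) from rfl, truncPow_natCast, truncPow_natCast]
      simp only [hPm _ ((n : ℤ), (m : ℤ)) m rfl]
    · intro m hm
      have hlt : n < K * m := by
        rw [Finset.mem_range, not_lt, Nat.succ_le_iff, Nat.div_lt_iff_lt_mul hK] at hm
        rwa [mul_comm]
      have hneg : (n : ℤ) - K * m < 0 := by
        have : (n : ℤ) < K * m := by exact_mod_cast hlt
        omega
      simp [π, κ, truncPow_of_neg _ hneg]
  simpa [S] using hS.isBinomialMultisum

theorem prod_add_div_mul_factorial (j u : ℕ) {t : ℕ} (ht : 0 < t) :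
    (∏ s ∈ Finset.range u, ((j : ℝ) + ((s : ℝ) + 1) / t)) * (((j * t).factorial : ℝ) * (t : ℝ) ^ u) =
      ((j * t + u).factorial : ℝ) := by
  induction u with
  | zero => simp
  | succ u ih =>
    rw [Finset.prod_range_succ, ← add_assoc, Nat.factorial_succ, Nat.cast_mul, ← ih]
    have : (t : ℝ) ≠ 0 := by positivity
    push_cast
    field_simp
    ring

theorem prod_add_Upsilon {p k : ℕ} {lam : Fin k → ℕ} {a : Fin p → ℚ}
    (ha : (List.ofFn a : Multiset ℚ) = Upsilon lam) (j : ℕ) :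
    ∏ i, ((j : ℝ) + (a i : ℝ)) =
      ∏ i, ∏ s ∈ Finset.range (lam i), ((j : ℝ) + ((s : ℝ) + 1) / (lam i : ℝ)) := by
  let f : ℚ → ℝ := fun q => (j : ℝ) + (q : ℝ)
  calc ∏ i, ((j : ℝ) + (a i : ℝ))
      = (Multiset.map f (List.ofFn a : Multiset ℚ)).prod := by
        simp [f, List.map_ofFn, List.prod_ofFn]
    _ = _ := by
        rw [ha, Upsilon, ← Multiset.coe_mapAddMonoidHom, map_sum, Multiset.prod_sum]
        refine Finset.prod_congr rfl fun i _ => ?_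
        rw [Multiset.coe_mapAddMonoidHom, Multiset.map_map, Finset.prod, Finset.range_val]
        simp [f]

theorem prod_range_prod_add_Upsilon {p k : ℕ} {lam : Fin k → ℕ} (hlam : ∀ i, 0 < lam i)
    {a : Fin p → ℚ} (ha : (List.ofFn a : Multiset ℚ) = Upsilon lam) (m : ℕ) :
    (∏ j ∈ Finset.range m, ∏ i, ((j : ℝ) + (a i : ℝ))) * (∏ i, (lam i : ℝ) ^ lam i) ^ m =
      ∏ i, ((lam i * m).factorial : ℝ) := by
  induction m with
  | zero => simp
  | succ m ih =>
    have h : ∏ i, ((lam i * (m + 1)).factorial : ℝ) =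
        (∏ i, ∏ s ∈ Finset.range (lam i), ((m : ℝ) + ((s : ℝ) + 1) / (lam i : ℝ))) *
          ((∏ i, ((lam i * m).factorial : ℝ)) * ∏ i, (lam i : ℝ) ^ lam i) := by
      simp only [← Finset.prod_mul_distrib]
      refine Finset.prod_congr rfl fun i _ => ?_
      rw [mul_comm (lam i) m, prod_add_div_mul_factorial m (lam i) (hlam i)]
      congr 2
      ring
    rw [h, ← ih, Finset.prod_range_succ, prod_add_Upsilon ha m]
    ring

theorem prod_factorial_mul_prod_multinomial {k l : ℕ} {μ : Fin k → ℕ} {ν : Fin l → ℕ}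
    {g : Fin l → Fin k}
    (href : ∀ i, ∑ j ∈ Finset.univ.filter fun j => g j = i, ν j = μ i) (m : ℕ) :
    (∏ j, (ν j * m).factorial) *
        ∏ i, Nat.multinomial (Finset.univ.filter fun j => g j = i) (fun j => ν j * m) =
      ∏ i, (μ i * m).factorial := by
  rw [← Finset.prod_fiberwise Finset.univ g, ← Finset.prod_mul_distrib]
  refine Finset.prod_congr rfl fun i _ => ?_
  rw [Nat.multinomial_spec, ← Finset.sum_mul, href]

/-- **Hypergeometric constants as growth constants of tile counting functions.**
Let `μ ⊢ p` and let `ν ⊢ p` be a refinement of `μ`, let `{a₁,…,a_p} = Υ_μ` and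
`{b₁,…,b_p} = Υ_ν`, let `r = r₁/r₂` and suppose the hypergeometric series
`A = ∑_m ∏_{j<m} ((j+a₁)⋯(j+a_p)·r)/((j+b₁)⋯(j+b_p))` converges.  If every prime
dividing `μ₁⋯μ_k·r₂` divides `c`, then there is a binomial multisum (= tile counting
function) `f` with `f(n)/c^n → A`. -/
theorem hypergeometric_tileCounting
    (p k l : ℕ) (hp : 1 ≤ p)
    (μ : Fin k → ℕ) (hμpos : ∀ i, 0 < μ i) (hμanti : Antitone μ) (hμsum : ∑ i, μ i = p)
    (ν : Fin l → ℕ) (hνpos : ∀ i, 0 < ν i) (hνanti : Antitone ν) (hνsum : ∑ i, ν i = p)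
    (g : Fin l → Fin k) (href : ∀ i, ∑ j ∈ Finset.univ.filter fun j => g j = i, ν j = μ i)
    (a b : Fin p → ℚ)
    (ha : (List.ofFn a : Multiset ℚ) = Upsilon μ)
    (hb : (List.ofFn b : Multiset ℚ) = Upsilon ν)
    (r₁ r₂ : ℕ) (hr₁ : 0 < r₁) (hr₂ : 0 < r₂)
    (A : ℝ)
    (hA : HasSum (fun m : ℕ => ∏ j ∈ Finset.range m,
            ((∏ i, ((j : ℝ) + (a i : ℝ))) * ((r₁ : ℝ) / (r₂ : ℝ))) /
              (∏ i, ((j : ℝ) + (b i : ℝ)))) A)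
    (c : ℕ) (hc : 0 < c)
    (hcdiv : ∀ q : ℕ, q.Prime → q ∣ (∏ i, μ i) * r₂ → q ∣ c) :
    ∃ f : ℕ → ℕ, IsBinomialMultisum f ∧
      Filter.Tendsto (fun n : ℕ => (f n : ℝ) / (c : ℝ) ^ n) Filter.atTop (nhds A) := by
  set D : ℕ := r₂ * ∏ i, μ i ^ μ i with hDdef
  set N : ℕ := r₁ * ∏ j, ν j ^ ν j with hNdef
  set M : ℕ → ℕ := fun m =>
    ∏ i, Nat.multinomial (Finset.univ.filter fun j => g j = i) fun j => ν j * m with hMdef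
  have hD : 0 < D := Nat.mul_pos hr₂ (Finset.prod_pos fun i _ => pow_pos (hμpos i) _)
  have hN : 0 < N := Nat.mul_pos hr₁ (Finset.prod_pos fun i _ => pow_pos (hνpos i) _)
  obtain ⟨K, hDK⟩ : ∃ K, D ∣ c ^ K := by
    refine (Nat.exists_dvd_pow_iff hD.ne' hc.ne').2 fun q hq => ?_
    obtain ⟨hq, hqD, -⟩ := Nat.mem_primeFactors.1 hq
    refine Nat.mem_primeFactors.2 ⟨hq, hcdiv q hq ?_, hc.ne'⟩
    rcases hq.dvd_mul.1 hqD with h | h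
    · exact h.mul_left _
    · obtain ⟨i, hi, h⟩ := (hq.prime.dvd_finsetProd_iff _).1 h
      exact ((hq.dvd_of_dvd_pow h).trans (Finset.dvd_prod_of_mem μ hi)).mul_right _
  have hDK' : D ∣ c ^ (K + 1) := hDK.trans (pow_dvd_pow c K.le_succ)
  obtain ⟨E, hE⟩ := hDK'
  have hE0 : 0 < E := Nat.pos_of_ne_zero fun h => by simp [h, hc.ne'] at hE
  refine ⟨_, isBinomialMultisum_sum_multinomial ν g (Nat.mul_pos hN hE0) hc K.succ_pos, ?_⟩
  have hterm (m : ℕ) : ∏ j ∈ Finset.range m,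
      ((∏ i, ((j : ℝ) + (a i : ℝ))) * ((r₁ : ℝ) / (r₂ : ℝ))) / (∏ i, ((j : ℝ) + (b i : ℝ))) =
      (N : ℝ) ^ m / (D : ℝ) ^ m * M m := by
    have hα := prod_range_prod_add_Upsilon hμpos ha m
    have hβ := prod_range_prod_add_Upsilon hνpos hb m
    have hM : (∏ j, ((ν j * m).factorial : ℝ)) * M m = ∏ i, ((μ i * m).factorial : ℝ) := by
      exact_mod_cast prod_factorial_mul_prod_multinomial href m
    rw [Finset.prod_div_distrib, Finset.prod_mul_distrib, Finset.prod_const, Finset.card_range]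
    set α := ∏ j ∈ Finset.range m, ∏ i, ((j : ℝ) + (a i : ℝ))
    set β := ∏ j ∈ Finset.range m, ∏ i, ((j : ℝ) + (b i : ℝ))
    rw [← hα, ← hβ] at hM
    have hβ0 : β ≠ 0 := by
      rintro h
      rw [h, zero_mul] at hβ
      exact (Finset.prod_ne_zero_iff.2 fun j _ => by positivity) hβ.symm
    have hμ0 : (∏ i, (μ i : ℝ) ^ μ i) ≠ 0 :=
      Finset.prod_ne_zero_iff.2 fun i _ => pow_ne_zero _ (by exact_mod_cast (hμpos i).ne')
    have hr₂0 : (r₂ : ℝ) ≠ 0 := by positivity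
    simp only [hDdef, hNdef]
    push_cast
    rw [mul_pow, mul_pow, div_pow, eq_comm]
    field_simp
    linear_combination hM
  simp only [hterm] at hA
  have hlim : Filter.Tendsto (fun n : ℕ => n / (K + 1) + 1) Filter.atTop Filter.atTop :=
    (Filter.tendsto_add_atTop_nat 1).comp (Nat.tendsto_div_const_atTop K.succ_ne_zero)
  refine (hA.tendsto_sum_nat.comp hlim).congr fun n => ?_
  have hc0 : (c : ℝ) ≠ 0 := by positivity
  have hD0 : (D : ℝ) ≠ 0 := by positivity
  rw [Function.comp_apply, eq_div_iff (pow_ne_zero _ hc0), Finset.sum_mul, Nat.cast_sum]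
  refine Finset.sum_congr rfl fun m hm => ?_
  have hle : (K + 1) * m ≤ n := by
    rw [Finset.mem_range, Nat.lt_succ_iff, Nat.le_div_iff_mul_le K.succ_pos] at hm
    rwa [mul_comm]
  have hcn : (c : ℝ) ^ n = c ^ (n - (K + 1) * m) * ((D : ℝ) * E) ^ m := by
    rw [← Nat.cast_mul, ← hE, Nat.cast_pow, ← pow_mul, ← pow_add, Nat.sub_add_cancel hle]
  rw [hcn]
  simp only [hMdef]
  push_cast
  rw [mul_pow, mul_pow]
  field_simp
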